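/- arXiv:1704.03898 — 4 statements merged into one kernel-verified Lean document; each statement's English description precedes it below -/
import Mathlib

section
/- (Erdős–Rado Theorem) For every natural number r and every infinite cardinal μ, the partition relation ℶ_r(μ)⁺ → (μ⁺)^{r+1}_μ holds: for every coloring of the (r+1)-element subsets of a set of cardinality ℶ_r(μ)⁺ into μ many colors, there is a subset X of cardinality μ⁺ all of whose (r+1)-element subsets have the same color. -/
/-- The beth function with base `μ`: `ℶ_0(μ) = μ`, `ℶ_{r+1}(μ) = 2 ^ ℶ_r(μ)`. -/
def bethAt (μ : Cardinal) : ℕ → Cardinal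
  | 0 => μ
  | r + 1 => 2 ^ bethAt μ r

universe u

open Cardinal in
/-- Given `2 ^ κ` many operations of arity at most `κ`, some nonempty set of size at most `2 ^ κ` is
closed under all of them. -/
theorem exists_nonempty_closed_mk_le {κ : Cardinal.{u}} (hκ : ℵ₀ ≤ κ) {K G α : Type u}
    [Nonempty α] (hK : #K ≤ κ) (hG : #G ≤ 2 ^ κ) (F : G → (K → α) → α) :
    ∃ A : Set α, #A ≤ 2 ^ κ ∧ A.Nonempty ∧ ∀ g f, Set.range f ⊆ A → F g f ∈ A := by
  let arity : Option G → Type u := fun o => o.elim PEmpty fun _ => K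
  let value : WType arity → α := WType.elim α fun
    | ⟨none, _⟩ => Classical.arbitrary α
    | ⟨some g, f⟩ => F g f
  have h_inf : ℵ₀ ≤ 2 ^ κ := hκ.trans (cantor κ).le
  have hpow : ∀ o, ((2 : Cardinal.{u}) ^ κ) ^ #(arity o) ≤ 2 ^ κ := by
    intro o
    have ho : #(arity o) ≤ κ := by
      cases o with
      | none => simp [arity]
      | some g => exact hK
    rw [← power_mul]
    exact power_le_power_left two_ne_zero ((mul_le_mul_right ho κ).trans (mul_eq_self hκ).le)
  have hW : #(WType arity) ≤ 2 ^ κ := by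
    refine WType.cardinalMk_le_of_le ((sum_le_sum _ _ hpow).trans ?_)
    rw [sum_const', mk_option]
    exact (mul_le_mul_left (add_le_of_le h_inf hG (one_le_aleph0.trans h_inf)) _).trans
      (mul_eq_self h_inf).le
  refine ⟨Set.range value, mk_range_le.trans hW, ⟨_, ⟨none, PEmpty.elim⟩, rfl⟩, fun g f hf => ?_⟩
  choose w hw using fun k => hf (Set.mem_range_self k)
  refine ⟨⟨some g, w⟩, ?_⟩
  change F g (fun k => value (w k)) = F g f
  simp_rw [hw]

open Cardinal Classical in
/-- For a coloring of finite subsets, some set of size at most `2 ^ κ` realizes every type over each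
of its subsets of size at most `κ` that is realized outside that subset. -/
theorem exists_set_realizing_types {κ : Cardinal.{u}} (hκ : ℵ₀ ≤ κ) {α β : Type u} [Nonempty α]
    (hβ : #β ≤ κ) (c : Finset α → β) :
    ∃ A : Set α, #A ≤ 2 ^ κ ∧ ∀ x ∉ A, ∀ B ⊆ A, #B ≤ κ →
      ∃ y ∈ A, y ∉ B ∧ ∀ s : Finset α, ↑s ⊆ B → c (insert y s) = c (insert x s) := by
  let K := κ.out
  have hK : #K = κ := mk_out κ
  have : Infinite K := by rwa [infinite_iff, hK]
  have hG : #(Finset K → β) ≤ 2 ^ κ := by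
    rw [mk_arrow, lift_id, lift_id, mk_finset_of_infinite, hK, ← power_self_eq hκ]
    exact power_le_power_right hβ
  let IsRealized (g : Finset K → β) (f : K → α) (y : α) : Prop :=
    y ∉ Set.range f ∧ ∀ s : Finset K, c (insert y (s.image f)) = g s
  obtain ⟨A, hA, ⟨a, ha⟩, hclosed⟩ := exists_nonempty_closed_mk_le hκ hK.le hG
    fun g f => epsilon (IsRealized g f)
  refine ⟨A, hA, fun x hx B hBA hB => ?_⟩
  have hB' : #(insert a B : Set α) ≤ #K := by
    rw [hK]
    exact mk_insert_le.trans (add_le_of_le hκ hB (one_le_aleph0.trans hκ))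
  obtain ⟨e⟩ := hB'
  have : Nonempty (insert a B : Set α) := ⟨⟨a, Set.mem_insert a B⟩⟩
  let f : K → α := fun k => (Function.invFun ⇑e k).1
  have hf : Set.range f = insert a B := by
    change Set.range (Subtype.val ∘ Function.invFun e) = _
    rw [(Function.invFun_surjective e.injective).range_comp, Subtype.range_coe]
  have hfA : Set.range f ⊆ A := hf ▸ Set.insert_subset ha hBA
  have hreal := epsilon_spec (p := IsRealized (fun s => c (insert x (s.image f))) f)
    ⟨x, fun h => hx (hfA h), fun _ => rfl⟩
  refine ⟨_, hclosed _ f hfA, fun h => hreal.1 (hf.ge (Set.mem_insert_of_mem a h)), fun s hs => ?_⟩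
  obtain ⟨t, -, rfl⟩ := Finset.subset_set_image_iff.1
    (show (s : Set α) ⊆ f '' Set.univ by
      rw [Set.image_univ, hf]; exact hs.trans (Set.subset_insert a B))
  exact hreal.2 t

open Cardinal Classical in
/-- A coloring of finite subsets of a set larger than `2 ^ κ` admits an end-homogeneous sequence of
length `κ⁺`: the color of a finite set of terms depends only on the terms before the last. -/
theorem exists_end_homogeneous {κ : Cardinal.{u}} (hκ : ℵ₀ ≤ κ) {α β : Type u}
    (hα : 2 ^ κ < #α) (hβ : #β ≤ κ) (c : Finset α → β) :
    ∃ (y : (Order.succ κ).ord.ToType → α) (x : α), Function.Injective y ∧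
      ∀ i, ∀ t : Finset (Order.succ κ).ord.ToType, (∀ j ∈ t, j < i) →
        c (insert (y i) (t.image y)) = c (insert x (t.image y)) := by
  have : Nonempty α := mk_ne_zero_iff.1 (ne_bot_of_gt hα)
  obtain ⟨A, hA, hreal⟩ := exists_set_realizing_types hκ hβ c
  obtain ⟨x, hx⟩ : ∃ x, x ∉ A := by
    by_contra! h
    rw [Set.eq_univ_of_forall h, mk_univ] at hA
    exact hA.not_gt hα
  have hIio (i : (Order.succ κ).ord.ToType) : #(Set.Iio i) ≤ κ :=
    Order.lt_succ_iff.1 (mk_Iio_lt i (by simp) |>.trans_eq (mk_ord_toType _))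
  choose next hnextA hnext hnextc using hreal x hx
  let step (i : (Order.succ κ).ord.ToType) (prev : ∀ j < i, A) : A :=
    ⟨next (Set.range fun j : Set.Iio i => (prev j j.2 : α))
      (Set.range_subset_iff.2 fun j => (prev j j.2).2) (mk_range_le.trans (hIio i)), hnextA _ _ _⟩
  let y : (Order.succ κ).ord.ToType → A := wellFounded_lt.fix step
  have hy (i) : (y i : α) = next (Set.range fun j : Set.Iio i => (y j : α))
      (Set.range_subset_iff.2 fun j => (y j).2) (mk_range_le.trans (hIio i)) :=
    congrArg Subtype.val (wellFounded_lt.fix_eq step i)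
  have hne {i j} (h : j < i) : (y j : α) ≠ y i := by
    rw [hy i]
    exact fun h' => hnext (Set.range fun k : Set.Iio i => (y k : α)) _ _ ⟨⟨j, h⟩, h'⟩
  refine ⟨fun i => y i, x, Function.Injective.of_lt_imp_ne fun _ _ => hne, fun i t ht => ?_⟩
  dsimp only
  rw [hy i]
  refine hnextc _ _ _ _ fun a ha => ?_
  obtain ⟨j, hj, rfl⟩ := Finset.mem_image.1 (Finset.mem_coe.1 ha)
  exact ⟨⟨j, ht j hj⟩, rfl⟩

theorem le_bethAt (μ : Cardinal.{u}) (r : ℕ) : μ ≤ bethAt μ r := by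
  induction r with
  | zero => exact le_rfl
  | succ r ih => exact ih.trans (Cardinal.cantor _).le

/-- **Erdős–Rado Theorem.** For every natural number `r` and infinite cardinal `μ`,
`ℶ_r(μ)⁺ → (μ⁺)^{r+1}_μ`: for every coloring of the `(r+1)`-element subsets of a set of
cardinality `ℶ_r(μ)⁺` into `μ` many colors, there is a subset of cardinality `μ⁺` all of whose
`(r+1)`-element subsets get the same color. -/
theorem erdos_rado (r : ℕ) (μ : Cardinal.{u}) (hμ : Cardinal.aleph0 ≤ μ)
    {α : Type u} (hα : Cardinal.mk α = Order.succ (bethAt μ r))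
    {β : Type u} (hβ : Cardinal.mk β = μ)
    (c : Finset α → β) :
    ∃ X : Set α, Cardinal.mk X = Order.succ μ ∧
      ∃ b : β, ∀ s : Finset α, ↑s ⊆ X → s.card = r + 1 → c s = b := by
  classical
  induction r generalizing α with
  | zero =>
    have hμs : Cardinal.aleph0 ≤ Order.succ μ := hμ.trans (Order.le_succ μ)
    obtain ⟨b, hb⟩ := Cardinal.infinite_pigeonhole_card (fun a : α => c {a}) (Order.succ μ)
      hα.ge hμs (by
        rw [(Cardinal.isRegular_succ hμ).cof_ord, hβ]
        exact Order.lt_succ μ)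
    obtain ⟨X, hXsub, hX⟩ := Cardinal.le_mk_iff_exists_subset.1 hb
    refine ⟨X, hX, b, fun s hs hcard => ?_⟩
    obtain ⟨a, rfl⟩ := Finset.card_eq_one.1 hcard
    exact hXsub (hs (by simp))
  | succ r ih =>
    have hμκ := le_bethAt μ r
    obtain ⟨y, x, hy, hend⟩ := exists_end_homogeneous (hμ.trans hμκ)
      (hα ▸ Order.lt_succ (2 ^ bethAt μ r)) (hβ.le.trans hμκ) c
    obtain ⟨X, hX, b, hb⟩ := ih (Cardinal.mk_ord_toType _) fun t => c (insert x (t.image y))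
    refine ⟨y '' X, (Cardinal.mk_image_eq hy).trans hX, b, fun s hs hcard => ?_⟩
    obtain ⟨t, htX, rfl⟩ := Finset.subset_set_image_iff.1 hs
    rw [Finset.card_image_of_injective t hy] at hcard
    have ht : t.Nonempty := Finset.card_pos.1 (by omega)
    have hmax := t.max'_mem ht
    rw [← Finset.insert_erase hmax, Finset.image_insert,
      hend _ _ fun j hj => t.lt_max'_of_mem_erase_max' ht hj]
    refine hb _ (fun j hj => htX (Finset.mem_of_mem_erase hj)) ?_
    rw [Finset.card_erase_of_mem hmax]
    omega
end

section
/- (Milliken's Theorem) For each k < ω, each infinite strong subtree T of 2^{<ω}, and each coloring of the set of all finite strong subtrees of T with k levels into finitely many colors, there is an infinite strong subtree S of T such that all finite strong subtrees of S with k levels have the same color. -/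
/-- The downward closure (set of all initial segments) of a set of nodes of `2^{<ω}`. -/
def downcl (S : Set (List Bool)) : Set (List Bool) := {u | ∃ t ∈ S, u <+: t}

/-- A node `s` splits in `S` if both of its immediate extensions lie in the downward closure
of `S`, i.e. both are extended by nodes of `S`. -/
def Splits (S : Set (List Bool)) (s : List Bool) : Prop :=
  s ++ [false] ∈ downcl S ∧ s ++ [true] ∈ downcl S

/-- `S` is a strong subtree of `2^{<ω}` witnessed by the set of levels `L`:
`S` equals the union of its level sets at levels in `L` (every node of `S` has length in `L`,
and every node of the downward closure of `S` at a level in `L` belongs to `S`), every node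
of `S` splits into both immediate extensions inside `S`, no node splits at a level outside
`L`, and every level in `L` is the level of some node of `S`. -/
def IsStrongTree (S : Set (List Bool)) (L : Set ℕ) : Prop :=
  S.Nonempty ∧
  (∀ s ∈ S, s.length ∈ L) ∧
  (∀ s ∈ downcl S, s.length ∈ L → s ∈ S) ∧
  (∀ s ∈ S, Splits S s) ∧
  (∀ s ∈ downcl S, Splits S s → s.length ∈ L) ∧
  (∀ l ∈ L, ∃ s ∈ S, s.length = l)

/-- An infinite strong subtree of `2^{<ω}`: one witnessed by an infinite set of levels. -/
def IsInfStrongTree (S : Set (List Bool)) : Prop :=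
  ∃ L : Set ℕ, L.Infinite ∧ IsStrongTree S L

/-- `S` is a finite strong tree witnessed by the finite set of levels `L`: every node of `S`
has length in `L`, every node of the downward closure of `S` at a level in `L` belongs to `S`,
every node of `S` at a non-maximal level splits into both immediate extensions inside `S`,
no node splits at a level outside `L`, and every level of `L` is realized. -/
def IsFinStrongTree (S : Set (List Bool)) (L : Finset ℕ) : Prop :=
  S.Nonempty ∧
  (∀ s ∈ S, s.length ∈ L) ∧
  (∀ s ∈ downcl S, s.length ∈ (L : Set ℕ) → s ∈ S) ∧
  (∀ s ∈ S, (∃ l ∈ L, s.length < l) → Splits S s) ∧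
  (∀ s ∈ downcl S, Splits S s → s.length ∈ L) ∧
  (∀ l ∈ L, ∃ s ∈ S, s.length = l)

/-- Substitution of the letter `a` for the variable `none` in a variable word. -/
def substLetter {A : Type*} (a : A) (w : List (Option A)) : List A := w.map fun o => o.getD a

/-- Substitution of the letters of `u` in the sequence of variable words `y`, after `w`. -/
def substWord {A : Type*} (w : List A) (y : ℕ → List (Option A)) (u : List A) : List A :=
  w ++ (u.mapIdx fun i a => substLetter a (y i)).flatten

theorem substWord_nil {A : Type*} (w : List A) (y : ℕ → List (Option A)) :
    substWord w y [] = w := by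
  simp [substWord]

theorem substWord_concat {A : Type*}
    (w : List A) (y : ℕ → List (Option A)) (u : List A) (a : A) :
    substWord w y (u ++ [a]) = substWord w y u ++ substLetter a (y u.length) := by
  simp [substWord]

section Ultrafilters

attribute [local instance] Ultrafilter.mul Ultrafilter.semigroup

theorem Ultrafilter.map_mulHom {M N : Type*} [Mul M] [Mul N] (f : M →ₙ* N)
    (U V : Ultrafilter M) : (U * V).map f = U.map f * V.map f := by
  refine Ultrafilter.coe_inj.mp (Filter.ext' fun p => ?_)
  rw [Ultrafilter.eventually_mul]
  simp only [Ultrafilter.coe_map, Filter.eventually_map]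
  rw [Ultrafilter.eventually_mul]
  simp only [map_mul]

/-- A compact right topological semigroup has an element generating a minimal left ideal. -/
theorem exists_generator_minimal_left_ideal {M : Type*} [Nonempty M] [Semigroup M]
    [TopologicalSpace M] [CompactSpace M] [T2Space M]
    (continuous_mul_left : ∀ r : M, Continuous (· * r)) :
    ∃ p : M, ∀ x : M, ∃ y : M, y * (x * p) = p := by
  let S : Set (Set M) := {N | IsClosed N ∧ N.Nonempty ∧ ∀ m, ∀ n ∈ N, m * n ∈ N}
  have huniv : (Set.univ : Set M) ∈ S := ⟨isClosed_univ, Set.univ_nonempty, by simp⟩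
  obtain ⟨N, -, hN⟩ : ∃ N, N ⊆ Set.univ ∧ Minimal (· ∈ S) N := by
    refine zorn_superset_nonempty S (fun c hcs hc hne => ?_) _ huniv
    refine ⟨⋂₀ c, ⟨isClosed_sInter fun t ht => (hcs ht).1, ?_, fun m n hn => ?_⟩,
      fun s hs => Set.sInter_subset_of_mem hs⟩
    · exact IsCompact.nonempty_sInter_of_directed_nonempty_isCompact_isClosed
        (S := c) (hS := hne.to_subtype) (IsChain.directedOn hc.symm) (fun i hi => (hcs hi).2.1)
        (fun i hi => (hcs hi).1.isCompact) (fun i hi => (hcs hi).1)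
    · rw [Set.mem_sInter] at hn ⊢
      exact fun t ht => (hcs ht).2.2 m n (hn t ht)
  obtain ⟨-, ⟨p, hp⟩, hmul⟩ := hN.prop
  refine ⟨p, fun x => ?_⟩
  have hx : x * p ∈ N := hmul _ _ hp
  have : (· * (x * p)) '' Set.univ = N := by
    apply hN.eq_of_subset
    · refine ⟨(continuous_mul_left _).isClosedMap _ isClosed_univ, ⟨_, x, trivial, rfl⟩, ?_⟩
      rintro m _ ⟨n, -, rfl⟩
      exact ⟨m * n, trivial, mul_assoc _ _ _⟩
    · rintro _ ⟨n, -, rfl⟩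
      exact hmul _ _ hx
  rw [← this] at hp
  obtain ⟨y, -, hy⟩ := hp
  exact ⟨y, hy⟩

/-- If the homomorphisms `T a : S → W` share the section `e`, then every right ideal of `S`
carries an ultrafilter whose images under the `T a` are right absorbing among each other. -/
theorem exists_ultrafilter_map_mul_eq {ι S W : Type*} [Semigroup S] [Semigroup W] [Nonempty W]
    (T : ι → S →ₙ* W) (e : W →ₙ* S) (hTe : ∀ a w, T a (e w) = w)
    (R : Set S) (hne : R.Nonempty) (hR : ∀ x ∈ R, ∀ y, x * y ∈ R) :
    ∃ q : Ultrafilter S, R ∈ q ∧ ∀ a b, q.map (T a) * q.map (T b) = q.map (T a) := by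
  obtain ⟨p, hp⟩ := exists_generator_minimal_left_ideal (M := Ultrafilter W)
    Ultrafilter.continuous_mul_left
  obtain ⟨x₀, hx₀⟩ := hne
  have hRmul : ∀ k : Ultrafilter S, R ∈ k → ∀ l, R ∈ k * l := by
    intro k hk l
    change ∀ᶠ m in ↑(k * l), m ∈ R
    rw [Ultrafilter.eventually_mul]
    filter_upwards [hk] with x hx
    exact Filter.Eventually.of_forall fun y => hR x hx y
  have hTep : ∀ a, (p.map e).map (T a) = p := by
    intro a
    rw [Ultrafilter.map_map]
    convert p.map_id
    funext w
    exact hTe a w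
  obtain ⟨q, ⟨k, hk, rfl⟩, hq⟩ := exists_idempotent_in_compact_subsemigroup
    (M := Ultrafilter S) Ultrafilter.continuous_mul_left
    ((· * p.map e) '' {k | R ∈ k})
    ⟨_, pure x₀, by simpa using hx₀, rfl⟩
    ((ultrafilter_isClosed_basic R).isCompact.image (Ultrafilter.continuous_mul_left _))
    (by
      rintro _ ⟨k, hk, rfl⟩ _ ⟨l, hl, rfl⟩
      refine ⟨k * p.map e * l, hRmul _ (hRmul _ hk _) _, ?_⟩
      simp only [mul_assoc])
  refine ⟨k * p.map e, hRmul _ hk _, fun a b => ?_⟩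
  have hidem : ∀ b, ((k * p.map e).map (T b)) * ((k * p.map e).map (T b))
      = (k * p.map e).map (T b) := by
    intro b
    rw [← Ultrafilter.map_mulHom]
    exact congrArg _ hq
  have hform : ∀ b, (k * p.map e).map (T b) = k.map (T b) * p := by
    intro b
    rw [Ultrafilter.map_mulHom, hTep]
  obtain ⟨y, hy⟩ := hp (k.map (T b))
  have : (k * p.map e).map (T a) = (k.map (T a) * y) * (k * p.map e).map (T b) := by
    rw [hform, hform, mul_assoc, hy]
  rw [this, mul_assoc, hidem]

/-- There is an ultrafilter on variable words that concentrates on left variable words and whose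
images under substitutions are right absorbing among each other. -/
theorem exists_ultrafilter_substLetter (A : Type*) :
    ∃ q : Ultrafilter (List (Option A)),
      (∀ᶠ y in (q : Filter (List (Option A))), ∃ z, y = none :: z) ∧
      ∀ (a b : A) (P : List A → Prop), (∀ᶠ y in q, P (substLetter a y)) →
        ∀ᶠ y in q, ∀ᶠ z in q, P (substLetter a y ++ substLetter b z) := by
  obtain ⟨q, hqR, hq⟩ := exists_ultrafilter_map_mul_eq
    (S := FreeMonoid (Option A)) (W := FreeMonoid A)
    (fun a : A => (FreeMonoid.map fun o => o.getD a).toMulHom)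
    (FreeMonoid.map some).toMulHom
    (fun a w => by
      change FreeMonoid.map _ (FreeMonoid.map _ w) = w
      rw [FreeMonoid.map_map]
      exact DFunLike.congr_fun FreeMonoid.map_id w)
    {x | ∃ z, x.toList = none :: z} ⟨FreeMonoid.ofList [none], [], rfl⟩
    (by
      rintro x ⟨z, hz⟩ y
      exact ⟨z ++ y.toList, by rw [FreeMonoid.toList_mul, hz]; rfl⟩)
  refine ⟨q, hqR, fun a b P h => ?_⟩
  let Q : A → Ultrafilter (FreeMonoid A) := fun a => Ultrafilter.map (substLetter a) q
  have hQ : Q a * Q b = Q a := hq a b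
  have hP : ∀ᶠ w : FreeMonoid A in (Q a : Filter (FreeMonoid A)), P w.toList := h
  rw [← hQ] at hP
  exact (Ultrafilter.eventually_mul _ _ _).1 hP

end Ultrafilters

/-- The Carlson–Simpson theorem for left variable words. -/
theorem carlson_simpson {A κ : Type*} [Finite A] [Nonempty A] [Finite κ] (χ : List A → κ) :
    ∃ (w : List A) (y : ℕ → List (Option A)), (∀ n, ∃ z, y n = none :: z) ∧
      ∃ ε, ∀ u, χ (substWord w y u) = ε := by
  classical
  have := Fintype.ofFinite A
  obtain ⟨q, hqR, hq⟩ := exists_ultrafilter_substLetter A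
  obtain ⟨a₀⟩ := ‹Nonempty A›
  obtain ⟨ε, hε⟩ : ∃ ε, ∀ᶠ y in q, χ (substLetter a₀ y) = ε :=
    Ultrafilter.eventually_exists_iff.1 (Filter.Eventually.of_forall fun y => ⟨_, rfl⟩)
  let G : Set (List A) :=
    {x | χ x = ε ∧ ∀ a, ∀ᶠ y in q, χ (x ++ substLetter a y) = ε}
  obtain ⟨w, hw⟩ : ∃ w, w ∈ G := by
    have : ∀ᶠ y in q, substLetter a₀ y ∈ G :=
      hε.and (Filter.eventually_all.2 fun a => hq a₀ a (fun x => χ x = ε) hε)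
    exact this.exists.imp' _ fun _ h => h
  have hstep : ∀ x ∈ G, ∀ a, ∀ᶠ y in q, x ++ substLetter a y ∈ G := by
    rintro x ⟨-, hx⟩ a
    refine (hx a).and (Filter.eventually_all.2 fun b => ?_)
    simpa only [List.append_assoc] using hq a b (fun z => χ (x ++ z) = ε) (hx a)
  have hfin : ∀ X : Finset (List A), ∃ y, (∃ z, y = none :: z) ∧
      ((∀ x ∈ X, x ∈ G) → ∀ x ∈ X, ∀ a, x ++ substLetter a y ∈ G) := by
    intro X
    by_cases hX : ∀ x ∈ X, x ∈ G
    · have : ∀ᶠ y in q, ∀ x ∈ X, ∀ a, x ++ substLetter a y ∈ G :=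
        (Filter.eventually_all_finset X).2 fun x hx =>
          Filter.eventually_all.2 fun a => hstep x (hX x hx) a
      obtain ⟨y, hy⟩ := (hqR.and this).exists
      exact ⟨y, hy.1, fun _ => hy.2⟩
    · exact ⟨[none], ⟨[], rfl⟩, fun h => absurd h hX⟩
  choose Y hY hYG using hfin
  let X : ℕ → Finset (List A) := fun n => Nat.rec {w}
    (fun _ X => (X ×ˢ Finset.univ).image fun p => p.1 ++ substLetter p.2 (Y X)) n
  have hX : ∀ n, X (n + 1) =
    (X n ×ˢ Finset.univ).image fun p => p.1 ++ substLetter p.2 (Y (X n)) := fun n => rfl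
  have hXG : ∀ n, ∀ x ∈ X n, x ∈ G := by
    intro n
    induction n with
    | zero => simpa [X] using hw
    | succ n ih =>
      intro z hz
      rw [hX, Finset.mem_image] at hz
      obtain ⟨p, hp, rfl⟩ := hz
      exact hYG _ ih _ (Finset.mem_product.1 hp).1 _
  refine ⟨w, fun n => Y (X n), fun n => hY _, ε, fun u => ?_⟩
  have hu : substWord w (fun n => Y (X n)) u ∈ X u.length := by
    induction u using List.reverseRecOn with
    | nil => simp [substWord_nil, X]
    | append_singleton u a ih =>
      rw [substWord_concat, List.length_append, List.length_singleton, hX]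
      exact Finset.mem_image.2 ⟨(_, a), Finset.mk_mem_product ih (Finset.mem_univ a), rfl⟩
  exact (hXG _ _ hu).1

/-- A strong embedding of the binary tree `2^{<ω}` into itself: it maps levels into levels and
respects both immediate successors of every node. -/
def IsStrongEmb (f : List Bool → List Bool) : Prop :=
  (∀ s t, s.length = t.length → (f s).length = (f t).length) ∧
    ∀ s b, f s ++ [b] <+: f (s ++ [b])

theorem substWord_map {A B : Type*} (g : A → B) (w : List A) (y : ℕ → List (Option A))
    (u : List A) :
    (substWord w y u).map g =
      substWord (w.map g) (fun n => (y n).map (Option.map g)) (u.map g) := by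
  induction u using List.reverseRecOn with
  | nil => simp [substWord_nil]
  | append_singleton u a ih =>
    rw [List.map_append, List.map_singleton, substWord_concat, substWord_concat, List.map_append,
      ih, List.length_map]
    congr 1
    simp only [substLetter, List.map_map]
    congr 1
    funext o
    cases o <;> rfl

theorem length_substWord {A B : Type*} (w : List A) (y : ℕ → List (Option A)) (w' : List B)
    (y' : ℕ → List (Option B)) (hw : w.length = w'.length)
    (hy : ∀ n, (y n).length = (y' n).length) (u : List A) (u' : List B)
    (hu : u.length = u'.length) : (substWord w y u).length = (substWord w' y' u').length := by
  induction u using List.reverseRecOn generalizing u' with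
  | nil =>
    obtain rfl : u' = [] := List.length_eq_zero_iff.1 hu.symm
    simpa [substWord_nil] using hw
  | append_singleton u a ih =>
    obtain rfl | ⟨v, b, rfl⟩ := u'.eq_nil_or_concat'
    · simp at hu
    · have huv : u.length = v.length := by simpa using hu
      rw [substWord_concat, substWord_concat, List.length_append, List.length_append, ih v huv]
      simp [substLetter, huv, hy]

/-- The Halpern–Läuchli theorem for level products of finitely many copies of `2^{<ω}`. -/
theorem halpern_lauchli {I κ : Type*} [Finite I] [Finite κ] (χ : (I → List Bool) → κ) :
    ∃ S : I → List Bool → List Bool, (∀ i, IsStrongEmb (S i)) ∧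
      (∀ i j s t, s.length = t.length → (S i s).length = (S j t).length) ∧
      ∃ ε, ∀ (x : I → List Bool) (m : ℕ), (∀ i, (x i).length = m) →
        χ (fun i => S i (x i)) = ε := by
  obtain ⟨w, y, hy, ε, hε⟩ :=
    carlson_simpson (A := I → Bool) fun w => χ fun i => w.map fun a => a i
  have hlen : ∀ i j s t, s.length = t.length →
      (substWord (w.map fun a => a i) (fun n => (y n).map (Option.map fun a => a i)) s).length =
      (substWord (w.map fun a => a j) (fun n => (y n).map (Option.map fun a => a j)) t).length :=
    fun i j s t h => length_substWord _ _ _ _ (by simp) (by simp) _ _ h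
  refine ⟨fun i => substWord (w.map fun a => a i) fun n => (y n).map (Option.map fun a => a i),
    fun i => ⟨hlen i i, fun s b => ?_⟩, hlen, ε, fun x m hx => ?_⟩
  · obtain ⟨z, hz⟩ := hy s.length
    simp only [substWord_concat, List.prefix_append_right_inj, hz]
    simp [substLetter]
  · rw [← hε (List.ofFn fun (j : Fin m) i => (x i)[j]'(by rw [hx]; exact j.2))]
    congr 1
    funext i
    rw [substWord_map]
    congr 1
    apply List.ext_getElem <;> simp [hx]
namespace IsStrongEmb

variable {f g : List Bool → List Bool}

theorem id : IsStrongEmb fun s => s := ⟨fun _ _ h => h, fun _ _ => List.prefix_rfl⟩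

theorem prefix_mono (hf : IsStrongEmb f) {s t : List Bool} (h : s <+: t) : f s <+: f t := by
  obtain ⟨r, rfl⟩ := h
  induction r using List.reverseRecOn with
  | nil => simp
  | append_singleton r b ih =>
    rw [← List.append_assoc]
    exact ih.trans ((List.prefix_append _ _).trans (hf.2 _ b))

theorem append_prefix (hf : IsStrongEmb f) {s t : List Bool} {b : Bool} (h : s ++ [b] <+: t) :
    f s ++ [b] <+: f t :=
  (hf.2 s b).trans (hf.prefix_mono h)

theorem comp (hf : IsStrongEmb f) (hg : IsStrongEmb g) : IsStrongEmb fun s => f (g s) :=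
  ⟨fun s t h => hf.1 _ _ (hg.1 s t h), fun s b => hf.append_prefix (hg.2 s b)⟩

theorem length_lt (hf : IsStrongEmb f) {s t : List Bool} (h : s.length < t.length) :
    (f s).length < (f t).length := by
  have h1 : (f s).length = (f (t.take s.length)).length := hf.1 _ _ (by simp; omega)
  have h2 := (hf.append_prefix (List.take_concat_get' t _ h ▸ List.take_prefix (s.length + 1) t :
    t.take s.length ++ [t[s.length]] <+: t)).length_le
  simp only [List.length_append, List.length_singleton] at h2
  omega

theorem length_le_iff (hf : IsStrongEmb f) {s t : List Bool} :
    (f s).length ≤ (f t).length ↔ s.length ≤ t.length := by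
  refine ⟨fun h => not_lt.1 fun h' => (hf.length_lt h').not_ge h, fun h => ?_⟩
  rcases h.lt_or_eq with h | h
  · exact (hf.length_lt h).le
  · exact (hf.1 _ _ h).le

theorem length_eq_iff (hf : IsStrongEmb f) {s t : List Bool} :
    (f s).length = (f t).length ↔ s.length = t.length := by
  simp only [le_antisymm_iff, hf.length_le_iff]

theorem injective (hf : IsStrongEmb f) : Function.Injective f := by
  intro s
  induction s using List.reverseRecOn with
  | nil =>
    intro t h
    have := hf.length_eq_iff.1 (congrArg List.length h)
    exact (List.length_eq_zero_iff.1 this.symm).symm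
  | append_singleton s b ih =>
    intro t h
    have hl := hf.length_eq_iff.1 (congrArg List.length h)
    obtain rfl | ⟨t, c, rfl⟩ := t.eq_nil_or_concat'
    · simp at hl
    have hl' : (f s).length = (f t).length := hf.1 _ _ (by simpa using hl)
    have h1 := hf.2 s b
    have h2 := hf.2 t c
    rw [← h] at h2
    have h3 := (List.prefix_of_prefix_length_le h1 h2 (by simp [hl'])).eq_of_length (by simp [hl'])
    obtain ⟨h4, h5⟩ := List.append_inj h3 hl'
    rw [ih h4, h5]

theorem append_prefix_iff (hf : IsStrongEmb f) {s t : List Bool} {b : Bool} :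
    f s ++ [b] <+: f t ↔ s ++ [b] <+: t := by
  refine ⟨fun h => ?_, hf.append_prefix⟩
  have hl : s.length < t.length := by
    by_contra! hc
    have := hf.length_le_iff.2 hc
    have := h.length_le
    simp only [List.length_append, List.length_singleton] at this
    omega
  have hp : t.take s.length ++ [t[s.length]] <+: t :=
    List.take_concat_get' t _ hl ▸ List.take_prefix (s.length + 1) t
  have hl' : (f s).length = (f (t.take s.length)).length := hf.1 _ _ (by simp; omega)
  have h3 := (List.prefix_of_prefix_length_le h (hf.append_prefix hp)
    (by simp [hl'])).eq_of_length (by simp [hl'])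
  obtain ⟨h4, h5⟩ := List.append_inj h3 hl'
  rw [← hf.injective h4] at hp
  rwa [h5]

end IsStrongEmb

/-- Strong embeddings above every node of level `n`, with common levels, glue with the identity
below level `n`. -/
theorem isStrongEmb_glue (n : ℕ) (S : {t : List Bool // t.length = n} → List Bool → List Bool)
    (hS : ∀ i, IsStrongEmb (S i))
    (hl : ∀ i j s t, s.length = t.length → (S i s).length = (S j t).length) :
    IsStrongEmb fun s => if h : n ≤ s.length then
      s.take n ++ S ⟨s.take n, by simpa using h⟩ (s.drop n) else s := by
  refine ⟨fun s t h => ?_, fun s b => ?_⟩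
  · dsimp only
    by_cases hs : n ≤ s.length
    · have ht : n ≤ t.length := h ▸ hs
      rw [dif_pos hs, dif_pos ht, List.length_append, List.length_append,
        hl _ ⟨t.take n, by simpa using ht⟩ _ (t.drop n) (by simp [h])]
      simp [hs, ht]
    · have ht : ¬ n ≤ t.length := h ▸ hs
      rw [dif_neg hs, dif_neg ht, h]
  · dsimp only
    by_cases hs : n ≤ s.length
    · have hs' : n ≤ (s ++ [b]).length := by simp; omega
      rw [dif_pos hs, dif_pos hs']
      simp only [List.take_append_of_le_length hs, List.drop_append_of_le_length hs,
        List.append_assoc, List.prefix_append_right_inj]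
      exact (hS _).2 _ _
    · rw [dif_neg hs]
      by_cases hs' : n ≤ (s ++ [b]).length
      · rw [dif_pos hs']
        have e : (s ++ [b]).take n = s ++ [b] := List.take_of_length_le (by simp; omega)
        have e' : s ++ [b] <+: (s ++ [b]).take n := by rw [e]
        exact e'.trans (List.prefix_append _ _)
      · rw [dif_neg hs']

/-- A value of a coloring of strong embeddings, as a function of the restriction to the levels at
most `k`, does not depend on the restriction to level `k`, after composition with a strong
embedding that is the identity below level `n`, provided that level `k` is the first one that is
not mapped below level `n`. -/
theorem exists_strongEmb_color_eq {κ : Type*} [Finite κ] (k n : ℕ)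
    (c : (List Bool → List Bool) → κ)
    (hc : ∀ f f', IsStrongEmb f → IsStrongEmb f' → (∀ s, s.length ≤ k → f s = f' s) →
      c f = c f') :
    ∃ h, IsStrongEmb h ∧ (∀ s, s.length < n → h s = s) ∧
      ∀ f f', IsStrongEmb f → IsStrongEmb f' → (∀ s, s.length < k → f s = f' s) →
        (k = 0 → n = 0) → (∀ s, s.length + 1 = k → (f s).length + 1 = n) →
        c (fun s => h (f s)) = c (fun s => h (f' s)) := by
  classical
  have hfin : ∀ m, Finite {t : List Bool // t.length ≤ m} := fun m =>
    (List.finite_length_le Bool m).to_subtype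
  have hfin' : Finite {t : List Bool // t.length = n} :=
    (List.finite_length_eq Bool n).to_subtype
  have hne : Nonempty κ := ⟨c fun s => s⟩
  let P : ({s : List Bool // s.length ≤ k} → {t : List Bool // t.length ≤ n}) →
      ({t : List Bool // t.length = n} → List Bool) → (List Bool → List Bool) → Prop :=
    fun τ x f => IsStrongEmb f ∧ (∀ s (hs : s.length < k), f s = (τ ⟨s, hs.le⟩ : List Bool)) ∧
      ∀ s (hs : s.length = k), ∃ h : (τ ⟨s, hs.le⟩ : List Bool).length = n,
        f s = (τ ⟨s, hs.le⟩ : List Bool) ++ x ⟨_, h⟩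
  let χ : ({t : List Bool // t.length = n} → List Bool) →
      ({s : List Bool // s.length ≤ k} → {t : List Bool // t.length ≤ n}) → κ :=
    fun x τ => if h : ∃ f, P τ x f then c h.choose else Classical.arbitrary κ
  have hχ : ∀ x τ f, P τ x f → χ x τ = c f := by
    intro x τ f hf
    have h : ∃ f, P τ x f := ⟨f, hf⟩
    have hg := h.choose_spec
    simp only [χ, dif_pos h]
    refine hc _ _ hg.1 hf.1 fun s hs => ?_
    rcases hs.lt_or_eq with hs | hs
    · rw [hg.2.1 s hs, hf.2.1 s hs]
    · obtain ⟨_, h1⟩ := hg.2.2 s hs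
      obtain ⟨_, h2⟩ := hf.2.2 s hs
      rw [h1, h2]
  obtain ⟨S, hS, hSl, ε, hε⟩ := halpern_lauchli χ
  refine ⟨_, isStrongEmb_glue n S hS hSl, fun s hs => dif_neg (by omega), ?_⟩
  set h : List Bool → List Bool := fun s => if h : n ≤ s.length then
      s.take n ++ S ⟨s.take n, by simpa using h⟩ (s.drop n) else s with hh
  have hhS : IsStrongEmb h := isStrongEmb_glue n S hS hSl
  have key : ∀ (τ : {s : List Bool // s.length ≤ k} → {t : List Bool // t.length ≤ n}) f,
      IsStrongEmb f → (k = 0 → n = 0) → (∀ s, s.length + 1 = k → (f s).length + 1 = n) →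
      (∀ s, (τ s : List Bool) = (f s).take n) → c (fun s => h (f s)) = ε τ := by
    intro τ f hf hk0 hk hτ
    have hlt : ∀ s, s.length < k → (f s).length < n := by
      intro s hs
      have h1 : (f s).length ≤ (f (List.replicate (k - 1) false)).length :=
        hf.length_le_iff.2 (by simp; omega)
      have := hk (List.replicate (k - 1) false) (by simp; omega)
      omega
    have hge : ∀ s, s.length = k → n ≤ (f s).length := by
      intro s hs
      obtain rfl | ⟨t, b, rfl⟩ := s.eq_nil_or_concat'
      · have := hk0 (by simpa using hs.symm)
        omega
      · have h1 := hk t (by simpa using hs)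
        have := (hf.2 t b).length_le
        simp only [List.length_append, List.length_singleton] at this
        omega
    have hinj : ∀ s t, s.length = k → t.length = k → (f s).take n = (f t).take n → s = t := by
      intro s t hs ht hst
      obtain rfl | ⟨s, b, rfl⟩ := s.eq_nil_or_concat'
      · subst hs
        exact (List.length_eq_zero_iff.1 ht).symm
      obtain rfl | ⟨t, b', rfl⟩ := t.eq_nil_or_concat'
      · subst ht
        exact List.length_eq_zero_iff.1 hs
      have hs1 := hk s (by simpa using hs)
      have ht1 := hk t (by simpa using ht)
      have e1 : (f (s ++ [b])).take n = f s ++ [b] :=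
        (List.prefix_iff_eq_take.1 (hf.2 s b)).symm ▸ by simp [hs1]
      have e2 : (f (t ++ [b'])).take n = f t ++ [b'] :=
        (List.prefix_iff_eq_take.1 (hf.2 t b')).symm ▸ by simp [ht1]
      rw [e1, e2] at hst
      obtain ⟨h4, h5⟩ := List.append_inj hst (by omega)
      rw [hf.injective h4, h5]
    let m := (f (List.replicate k false)).length - n
    have hm : ∀ s, s.length = k → ((f s).drop n).length = m := by
      intro s hs
      rw [List.length_drop, hf.1 s (List.replicate k false) (by simp [hs])]
    let x : {t : List Bool // t.length = n} → List Bool := fun t =>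
      if h : ∃ s, s.length = k ∧ (f s).take n = t then (f h.choose).drop n
      else List.replicate m false
    have hx : ∀ t, (x t).length = m := by
      intro t
      by_cases h : ∃ s, s.length = k ∧ (f s).take n = t
      · simp only [x, dif_pos h]
        exact hm _ h.choose_spec.1
      · simp [x, dif_neg h]
    have hx' : ∀ s (hs : s.length = k) ht, x ⟨(f s).take n, ht⟩ = (f s).drop n := by
      intro s hs ht
      have h : ∃ s', s'.length = k ∧ (f s').take n = (f s).take n := ⟨s, hs, rfl⟩
      simp only [x, dif_pos h]
      rw [hinj _ s h.choose_spec.1 hs h.choose_spec.2]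
    rw [← hε x m hx]
    refine (hχ (fun i => S i (x i)) τ (fun s => h (f s))
      ⟨hhS.comp hf, fun s hs => ?_, fun s hs => ?_⟩).symm
    · rw [hτ, List.take_of_length_le (hlt s hs).le]
      exact dif_neg (hlt s hs).not_ge
    · have hns := hge s hs
      refine ⟨by rw [hτ]; simpa using hns, ?_⟩
      simp only [hh, dif_pos hns, hτ]
      rw [hx' s hs]
  intro f f' hf hf' hff hk0 hk
  have hk' : ∀ s, s.length + 1 = k → (f' s).length + 1 = n := by
    intro s hs
    rw [← hff s (by omega)]
    exact hk s hs
  have htake : ∀ s, s.length ≤ k → (f s).take n = (f' s).take n := by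
    intro s hs
    rcases hs.lt_or_eq with hs | hs
    · rw [hff s hs]
    obtain rfl | ⟨t, b, rfl⟩ := s.eq_nil_or_concat'
    · simp [hk0 (by simpa using hs.symm)]
    have h1 := hk t (by simpa using hs)
    have e1 := List.prefix_iff_eq_take.1 (hf.2 t b)
    have e2 := List.prefix_iff_eq_take.1 (hf'.2 t b)
    rw [← hff t (by simp at hs; omega)] at e2
    rw [List.length_append, List.length_singleton, h1] at e1 e2
    rw [← e1, ← e2]
  rw [key (fun s => ⟨(f s).take n, by simp⟩) f hf hk0 hk fun s => rfl,
    key (fun s => ⟨(f s).take n, by simp⟩) f' hf' hk0 hk' fun s => htake s s.2]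

/-- The infinite composition of strong embeddings `h n` that are the identity below level `n`. -/
theorem exists_strongEmb_fusion (h : ℕ → List Bool → List Bool) (hh : ∀ n, IsStrongEmb (h n))
    (hid : ∀ n s, s.length < n → h n s = s) :
    ∃ F : ℕ → List Bool → List Bool, (∀ n, IsStrongEmb (F n)) ∧
      (∀ n s, s.length < n → F n s = s) ∧ ∀ n s, F n s = h n (F (n + 1) s) := by
  let H : ℕ → ℕ → List Bool → List Bool := fun m => Nat.rec (fun _ s => s)
    (fun _ H n s => h n (H (n + 1) s)) m
  have H0 : ∀ n s, H 0 n s = s := fun n s => rfl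
  have HS : ∀ m n s, H (m + 1) n s = h n (H m (n + 1) s) := fun m n s => rfl
  have hH : ∀ m n, IsStrongEmb (H m n) := by
    intro m
    induction m with
    | zero => exact fun n => IsStrongEmb.id
    | succ m ih => exact fun n => (hh n).comp (ih (n + 1))
  have hstep : ∀ m n s, s.length < n + m → H (m + 1) n s = H m n s := by
    intro m
    induction m with
    | zero => exact fun n s hs => hid n s hs
    | succ m ih =>
      intro n s hs
      rw [HS (m + 1) n s, HS m n s, ih (n + 1) s (by omega)]
  have hstable : ∀ m n s, s.length < n + m → ∀ j, H (m + j) n s = H m n s := by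
    intro m n s hs j
    induction j with
    | zero => rfl
    | succ j ih => rw [← ih, ← hstep (m + j) n s (by omega), Nat.add_assoc]
  have hF : ∀ m n s, s.length < n + m → H (s.length + 1) n s = H m n s := by
    intro m n s hs
    rcases le_total m (s.length + 1) with hm | hm
    · obtain ⟨j, hj⟩ := Nat.exists_eq_add_of_le hm
      rw [hj, hstable m n s hs]
    · obtain ⟨j, hj⟩ := Nat.exists_eq_add_of_le hm
      rw [hj, hstable _ n s (by omega)]
  refine ⟨fun n s => H (s.length + 1) n s, fun n => ⟨fun s t hst => ?_, fun s b => ?_⟩,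
    fun n s hs => hF 0 n s hs, fun n s => ?_⟩
  · simp only [hst]
    exact (hH (t.length + 1) n).1 s t hst
  · simp only
    rw [hF (s.length + 2) n s (by omega), hF (s.length + 2) n (s ++ [b]) (by simp; omega)]
    exact (hH (s.length + 2) n).2 s b
  · simp only
    rw [hF (s.length + 2) n s (by omega), HS]

/-- One fusion step of Milliken's theorem: the dependence of a coloring on the level `k` is
removed by passing to a strong subtree. -/
theorem exists_strongEmb_color_eq_of_agree {κ : Type*} [Finite κ] (k : ℕ)
    (c : (List Bool → List Bool) → κ)
    (hc : ∀ f f', IsStrongEmb f → IsStrongEmb f' → (∀ s, s.length ≤ k → f s = f' s) →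
      c f = c f') :
    ∃ g, IsStrongEmb g ∧ ∀ f f', IsStrongEmb f → IsStrongEmb f' →
      (∀ s, s.length < k → f s = f' s) → c (fun s => g (f s)) = c (fun s => g (f' s)) := by
  have hstep : ∀ (n : ℕ) (g : {g // IsStrongEmb g}), ∃ h, IsStrongEmb h ∧
      (∀ s, s.length < n → h s = s) ∧
      ∀ f f', IsStrongEmb f → IsStrongEmb f' → (∀ s, s.length < k → f s = f' s) →
        (k = 0 → n = 0) → (∀ s, s.length + 1 = k → (f s).length + 1 = n) →
        c (fun s => g.1 (h (f s))) = c (fun s => g.1 (h (f' s))) := by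
    intro n g
    exact exists_strongEmb_color_eq k n (fun f => c fun s => g.1 (f s))
      fun f f' hf hf' hff => hc _ _ (g.2.comp hf) (g.2.comp hf') fun s hs => by rw [hff s hs]
  choose h hh hid hcol using hstep
  let G : ℕ → {g // IsStrongEmb g} := fun n => Nat.rec ⟨fun s => s, IsStrongEmb.id⟩
    (fun n g => ⟨fun s => g.1 (h n g s), g.2.comp (hh n g)⟩) n
  have hG : ∀ n s, (G (n + 1)).1 s = (G n).1 (h n (G n) s) := fun n s => rfl
  obtain ⟨F, hF, hFid, hFs⟩ := exists_strongEmb_fusion (fun n => h n (G n))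
    (fun n => hh n _) (fun n => hid n _)
  have hGF : ∀ n s, (G n).1 (F n s) = F 0 s := by
    intro n s
    induction n with
    | zero => rfl
    | succ n ih => rw [hG, ← ih, hFs n]
  refine ⟨F 0, hF 0, fun f f' hf hf' hff => ?_⟩
  let n := if k = 0 then 0 else (f (List.replicate (k - 1) false)).length + 1
  have hn0 : k = 0 → n = 0 := fun hk => if_pos hk
  have hn : ∀ s, s.length + 1 = k → (f s).length + 1 = n := by
    intro s hs
    simp only [n, if_neg (show k ≠ 0 by omega)]
    rw [hf.1 s (List.replicate (k - 1) false) (by simp; omega)]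
  have := hcol n (G n) (fun s => F (n + 1) (f s)) (fun s => F (n + 1) (f' s))
    ((hF _).comp hf) ((hF _).comp hf') (fun s hs => by rw [hff s hs]) hn0
    (fun s hs => by rw [hFid _ _ (by have := hn s hs; omega)]; exact hn s hs)
  simpa only [← hG, hGF] using this

/-- Milliken's theorem in terms of strong embeddings. -/
theorem milliken_strongEmb {κ : Type*} [Finite κ] (k : ℕ) (c : (List Bool → List Bool) → κ)
    (hc : ∀ f f', IsStrongEmb f → IsStrongEmb f' → (∀ s, s.length < k → f s = f' s) →
      c f = c f') :
    ∃ g, IsStrongEmb g ∧ ∃ ε, ∀ f, IsStrongEmb f → c (fun s => g (f s)) = ε := by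
  induction k generalizing c with
  | zero =>
    exact ⟨fun s => s, IsStrongEmb.id, c fun s => s,
      fun f hf => hc _ _ hf IsStrongEmb.id (by simp)⟩
  | succ k ih =>
    obtain ⟨g, hg, hgc⟩ := exists_strongEmb_color_eq_of_agree k c fun f f' hf hf' hff =>
      hc f f' hf hf' fun s hs => hff s (by omega)
    obtain ⟨g', hg', ε, hε⟩ := ih (fun f => c fun s => g (f s)) hgc
    exact ⟨fun s => g (g' s), hg.comp hg', ε, hε⟩

theorem exists_prefix_split (s t : List Bool) :
    s <+: t ∨ t <+: s ∨ ∃ w b b', b ≠ b' ∧ w ++ [b] <+: s ∧ w ++ [b'] <+: t := by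
  induction s generalizing t with
  | nil => exact Or.inl List.nil_prefix
  | cons a s ih =>
    cases t with
    | nil => exact Or.inr (Or.inl List.nil_prefix)
    | cons a' t =>
      by_cases h : a = a'
      · subst h
        rcases ih t with h | h | ⟨w, b, b', hb, h1, h2⟩
        · exact Or.inl (by simpa using h)
        · exact Or.inr (Or.inl (by simpa using h))
        · exact Or.inr (Or.inr ⟨a :: w, b, b', hb, by simpa using h1, by simpa using h2⟩)
      · exact Or.inr (Or.inr ⟨[], a, a', h, by simp, by simp⟩)

theorem eq_of_append_prefix {s t : List Bool} {b b' : Bool} (h : s ++ [b] <+: t)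
    (h' : s ++ [b'] <+: t) : b = b' := by
  have := (List.prefix_of_prefix_length_le h h' (by simp)).eq_of_length (by simp)
  simpa using this

theorem splits_iff {S : Set (List Bool)} {s : List Bool} :
    Splits S s ↔ ∀ b, s ++ [b] ∈ downcl S := by
  simp [Splits, Bool.forall_bool]

/-- Nodes of equal length agree if they do up to a level from which on nothing splits. -/
theorem eq_of_take_eq {V : Set (List Bool)} {u v : List Bool} (m : ℕ) (hu : u ∈ V) (hv : v ∈ V)
    (hlen : u.length = v.length) (htake : u.take m = v.take m)
    (hsplit : ∀ s ∈ downcl V, m ≤ s.length → s.length < v.length → ¬ Splits V s) : u = v := by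
  rcases exists_prefix_split u v with h | h | ⟨w, b, b', hb, hwu, hwv⟩
  · exact h.eq_of_length hlen
  · exact (h.eq_of_length hlen.symm).symm
  · exfalso
    have hlt : w.length < v.length := by simpa using hwv.length_le
    refine hsplit w ⟨u, hu, (List.prefix_append _ _).trans hwu⟩ ?_ hlt ?_
    · by_contra! hm
      have h1 := List.prefix_take_iff.2 ⟨hwu, (by simpa using hm : (w ++ [b]).length ≤ m)⟩
      have h2 := List.prefix_take_iff.2 ⟨hwv, (by simpa using hm : (w ++ [b']).length ≤ m)⟩
      rw [htake] at h1
      exact hb (eq_of_append_prefix h1 h2)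
    · rw [splits_iff]
      intro a
      by_cases ha : a = b
      · exact ⟨u, hu, ha ▸ hwu⟩
      · have : a = b' := by cases a <;> cases b <;> cases b' <;> simp_all
        exact ⟨v, hv, this ▸ hwv⟩

theorem IsStrongEmb.range_isInfStrongTree {f : List Bool → List Bool} (hf : IsStrongEmb f) :
    IsInfStrongTree (Set.range f) := by
  refine ⟨Set.range fun s => (f s).length, ?_, ⟨_, [], rfl⟩, ?_, ?_, ?_, ?_, ?_⟩
  · refine (Set.infinite_range_of_injective (f := fun n => (f (List.replicate n false)).length)
      fun m n h => ?_).mono ?_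
    · simpa using hf.length_eq_iff.1 h
    · rintro _ ⟨n, rfl⟩
      exact ⟨_, rfl⟩
  · rintro _ ⟨s, rfl⟩
    exact ⟨s, rfl⟩
  · rintro s ⟨_, ⟨t, rfl⟩, hst⟩ ⟨u, hu⟩
    have hle : u.length ≤ t.length := hf.length_le_iff.1 (hu.trans_le hst.length_le)
    have hl : (f (t.take u.length)).length = s.length := by
      rw [← hu]
      exact hf.1 _ _ (by simpa using hle)
    exact ⟨t.take u.length, (List.prefix_of_prefix_length_le
      (hf.prefix_mono (List.take_prefix _ _)) hst hl.le).eq_of_length hl⟩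
  · rintro _ ⟨s, rfl⟩
    exact splits_iff.2 fun b => ⟨_, ⟨_, rfl⟩, hf.2 s b⟩
  · rintro s - ⟨⟨_, ⟨t, rfl⟩, ht⟩, ⟨_, ⟨t', rfl⟩, ht'⟩⟩
    rcases exists_prefix_split t t' with h | h | ⟨w, b, b', hb, h, h'⟩
    · cases eq_of_append_prefix (ht.trans (hf.prefix_mono h)) ht'
    · cases eq_of_append_prefix ht (ht'.trans (hf.prefix_mono h))
    · refine ⟨w, (le_antisymm ?_ ?_).symm⟩
      · by_contra! hlt
        refine hb (eq_of_append_prefix (s := f w) (t := s) ?_ ?_)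
        · exact List.prefix_of_prefix_length_le (hf.append_prefix h)
            ((List.prefix_append _ _).trans ht) (by simpa using hlt)
        · exact List.prefix_of_prefix_length_le (hf.append_prefix h')
            ((List.prefix_append _ _).trans ht') (by simpa using hlt)
      · by_contra! hlt
        have h1 : s ++ [false] <+: f w := List.prefix_of_prefix_length_le ht
          ((List.prefix_append _ _).trans (hf.append_prefix h)) (by simpa using hlt)
        have h2 : s ++ [true] <+: f w := List.prefix_of_prefix_length_le ht'
          ((List.prefix_append _ _).trans (hf.append_prefix h')) (by simpa using hlt)
        cases eq_of_append_prefix h1 h2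
  · rintro _ ⟨s, rfl⟩
    exact ⟨_, ⟨s, rfl⟩, rfl⟩

/-- A set of nodes in which every node has extensions of both kinds to the next level contains
the range of a strong embedding. -/
theorem exists_strongEmb_mem {V : Set (List Bool)} {l : ℕ → ℕ} (hl : StrictMono l)
    {r : List Bool} (hr : r ∈ V) (hrl : r.length = l 0)
    (hext : ∀ s ∈ V, ∀ j, s.length = l j → ∀ b, ∃ t ∈ V, t.length = l (j + 1) ∧ s ++ [b] <+: t) :
    ∃ f, IsStrongEmb f ∧ ∀ s, f s ∈ V ∧ (f s).length = l s.length := by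
  have hE : ∀ (s : List Bool) (b : Bool), ∃ t, s ++ [b] <+: t ∧
      (s ∈ V → ∀ j, s.length = l j → t ∈ V ∧ t.length = l (j + 1)) := by
    intro s b
    by_cases h : s ∈ V ∧ ∃ j, s.length = l j
    · obtain ⟨hs, j, hj⟩ := h
      obtain ⟨t, ht, htl, hst⟩ := hext s hs j hj b
      refine ⟨t, hst, fun _ i hi => ⟨ht, ?_⟩⟩
      rw [hl.injective (hi.symm.trans hj), htl]
    · exact ⟨_, List.prefix_rfl, fun hs j hj => absurd ⟨hs, j, hj⟩ h⟩
  choose E hE hEV using hE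
  have hconcat : ∀ s b, (s ++ [b]).foldl E r = E (s.foldl E r) b := by simp
  have hmem : ∀ s : List Bool, s.foldl E r ∈ V ∧ (s.foldl E r).length = l s.length := by
    intro s
    induction s using List.reverseRecOn with
    | nil => exact ⟨hr, hrl⟩
    | append_singleton s b ih =>
      rw [hconcat, List.length_append, List.length_singleton]
      exact hEV _ b ih.1 _ ih.2
  refine ⟨fun s => s.foldl E r, ⟨fun s t h => ?_, fun s b => ?_⟩, hmem⟩
  · rw [(hmem s).2, (hmem t).2, h]
  · show s.foldl E r ++ [b] <+: (s ++ [b]).foldl E r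
    rw [hconcat]
    exact hE _ b

theorem Splits.exists_append_prefix {V : Set (List Bool)} {L : Set ℕ}
    (hlen : ∀ s ∈ V, s.length ∈ L) (hcl : ∀ s ∈ downcl V, s.length ∈ L → s ∈ V)
    {s : List Bool} (hs : Splits V s) {m : ℕ} (hm : m ∈ L) (hsm : s.length < m)
    (hmin : ∀ i ∈ L, s.length < i → m ≤ i) (b : Bool) :
    ∃ t ∈ V, t.length = m ∧ s ++ [b] <+: t := by
  obtain ⟨t, ht, hst⟩ := splits_iff.1 hs b
  have hmt : m ≤ t.length := hmin _ (hlen t ht) (by simpa using hst.length_le)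
  have hl : (t.take m).length = m := by simpa using hmt
  exact ⟨t.take m, hcl _ ⟨t, ht, List.take_prefix _ _⟩ (by rwa [hl]), hl,
    List.prefix_take_iff.2 ⟨hst, by simpa using hsm⟩⟩

theorem IsInfStrongTree.exists_strongEmb {T : Set (List Bool)} (hT : IsInfStrongTree T) :
    ∃ f, IsStrongEmb f ∧ ∀ s, f s ∈ T := by
  obtain ⟨L, hL, -, hlen, hcl, hsplit, -, hreal⟩ := hT
  have hmono : StrictMono (Nat.nth (· ∈ L)) := Nat.nth_strictMono hL
  have hmem : ∀ j, Nat.nth (· ∈ L) j ∈ L := Nat.nth_mem_of_infinite hL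
  obtain ⟨r, hr, hrl⟩ := hreal _ (hmem 0)
  obtain ⟨f, hf, hfT⟩ := exists_strongEmb_mem hmono hr hrl fun s hs j hj b =>
    (hsplit s hs).exists_append_prefix hlen hcl (hmem (j + 1)) (hj ▸ hmono (Nat.lt_succ_self j))
      (fun i hi hsi => by
        by_contra! hlt
        have := Nat.le_nth_of_lt_nth_succ hlt hi
        omega) b
  exact ⟨f, hf, fun s => (hfT s).1⟩

theorem IsFinStrongTree.exists_strongEmb {V : Set (List Bool)} {L : Finset ℕ}
    (hV : IsFinStrongTree V L) :
    ∃ f, IsStrongEmb f ∧ V = f '' {s | s.length < L.card} := by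
  classical
  obtain ⟨⟨v₀, hv₀⟩, hlen, hcl, hsplit, hlev, hreal⟩ := hV
  obtain ⟨N, hN⟩ : ∃ N, ∀ i ∈ L, i ≤ N :=
    ⟨L.sup _root_.id, fun i hi => Finset.le_sup (f := _root_.id) hi⟩
  let p : ℕ → Prop := fun i => i ∈ L ∨ N < i
  have hp : (Set.ofPred p).Infinite :=
    (Set.Ioi_infinite N).mono fun i hi => Or.inr hi
  have hmono : StrictMono (Nat.nth p) := Nat.nth_strictMono hp
  have hmem : ∀ j, p (Nat.nth p j) := Nat.nth_mem_of_infinite hp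
  have hcount : Nat.count p (N + 1) = L.card := by
    rw [Nat.count_eq_card_filter_range]
    congr 1
    ext i
    simp only [Finset.mem_filter, Finset.mem_range, p]
    refine ⟨fun h => h.2.resolve_right (by omega), fun h => ⟨?_, Or.inl h⟩⟩
    have := hN i h
    omega
  have hnthL : ∀ j < L.card, Nat.nth p j ∈ L := by
    intro j hj
    have : Nat.nth p j < N + 1 := Nat.nth_lt_of_lt_count (by rwa [hcount])
    exact (hmem j).resolve_right (by omega)
  have hLnth : ∀ i ∈ L, ∃ j < L.card, Nat.nth p j = i := by
    intro i hi
    have hpi : p i := Or.inl hi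
    refine ⟨Nat.count p i, ?_, Nat.nth_count hpi⟩
    rw [← hcount]
    exact Nat.count_strict_mono hpi (by have := hN i hi; omega)
  have hnext : ∀ i ∈ L, ∀ j, Nat.nth p j < i → Nat.nth p (j + 1) ≤ i := by
    intro i hi j hij
    by_contra! hlt
    have := Nat.le_nth_of_lt_nth_succ hlt (Or.inl hi)
    omega
  have hcard : 0 < L.card := Finset.card_pos.2 ⟨_, hlen _ hv₀⟩
  obtain ⟨r, hr, hrl⟩ := hreal _ (hnthL 0 hcard)
  obtain ⟨f, hf, hfV⟩ := exists_strongEmb_mem (V := V ∪ {t | N < t.length}) hmono (Or.inl hr) hrl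
    (by
      intro s hs j hj b
      have hlt : s.length < Nat.nth p (j + 1) := hj ▸ hmono (Nat.lt_succ_self j)
      rcases hmem (j + 1) with h | h
      · have hsN : ¬ N < s.length := by have := hN _ h; omega
        have hsV : s ∈ V := hs.resolve_right hsN
        obtain ⟨t, ht, htl, hst⟩ := (hsplit s hsV ⟨_, h, hlt⟩).exists_append_prefix
          (L := (L : Set ℕ)) hlen hcl h hlt
          (fun i hi hsi => hnext i hi j (hj ▸ hsi)) b
        exact ⟨t, Or.inl ht, htl, hst⟩
      · have hl : (s ++ [b] ++ List.replicate (Nat.nth p (j + 1) - (s.length + 1)) false).length =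
            Nat.nth p (j + 1) := by
          simp only [List.length_append, List.length_singleton, List.length_replicate]
          omega
        exact ⟨_, Or.inr (by rw [Set.mem_ofPred_eq, hl]; exact h), hl, List.prefix_append _ _⟩)
  have hfV' : ∀ s, s.length < L.card → f s ∈ V := by
    intro s hs
    refine (hfV s).1.resolve_right ?_
    rw [Set.mem_ofPred_eq, (hfV s).2, not_lt]
    exact hN _ (hnthL _ hs)
  have hsurj : ∀ j < L.card, ∀ v ∈ V, v.length = Nat.nth p j → ∃ s, s.length = j ∧ f s = v := by
    intro j
    induction j with
    | zero =>
      intro _ v hv hvl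
      refine ⟨[], rfl, eq_of_take_eq 0 (hfV' [] hcard) hv ((hfV []).2.trans hvl.symm) (by simp) ?_⟩
      intro s hs _ hlt hsp
      obtain ⟨i, -, hi⟩ := hLnth _ (hlev s hs hsp)
      have := hmono.monotone (Nat.zero_le i)
      omega
    | succ j ih =>
      intro hj v hv hvl
      have hlt : Nat.nth p j < v.length := hvl ▸ hmono (Nat.lt_succ_self j)
      have hl : (v.take (Nat.nth p j)).length = Nat.nth p j := by simpa using hlt.le
      obtain ⟨s, hs, hfs⟩ := ih (by omega) _ (hcl (v.take (Nat.nth p j))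
        ⟨v, hv, List.take_prefix _ _⟩ (by rw [hl]; exact hnthL j (by omega))) hl
      have hsl : (s ++ [v[Nat.nth p j]]).length = j + 1 := by simp [hs]
      refine ⟨s ++ [v[Nat.nth p j]], hsl, ?_⟩
      refine eq_of_take_eq (Nat.nth p j + 1) (hfV' _ (by omega)) hv
        ((hfV _).2.trans (by rw [hsl, hvl])) ?_ ?_
      · have h1 := List.prefix_iff_eq_take.1 (hf.2 s v[Nat.nth p j])
        rw [List.length_append, List.length_singleton, hfs, hl] at h1
        rw [← h1, List.take_concat_get']
      · intro s hs hle hlt' hsp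
        have := hnext _ (hlev s hs hsp) j (by omega)
        omega
  refine ⟨f, hf, Set.Subset.antisymm (fun v hv => ?_) ?_⟩
  · obtain ⟨j, hj, hvl⟩ := hLnth _ (hlen v hv)
    obtain ⟨s, hs, rfl⟩ := hsurj j hj v hv hvl.symm
    exact ⟨s, hs.trans_lt hj, rfl⟩
  · rintro _ ⟨s, hs, rfl⟩
    exact hfV' s hs

theorem IsFinStrongTree.preimage {U : Set (List Bool)} {L : Finset ℕ} (hU : IsFinStrongTree U L)
    {g : List Bool → List Bool} (hg : IsStrongEmb g) (hUg : U ⊆ Set.range g) :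
    ∃ L' : Finset ℕ, L'.card = L.card ∧ IsFinStrongTree (g ⁻¹' U) L' := by
  obtain ⟨⟨v₀, hv₀⟩, hlen, hcl, hsplit, hlev, hreal⟩ := hU
  let l : ℕ → ℕ := fun n => (g (List.replicate n false)).length
  have hl : ∀ s, (g s).length = l s.length := fun s => hg.1 _ _ (by simp)
  have hinj : Function.Injective l := fun m n h => by simpa using hg.length_eq_iff.1 h
  have hrange : ∀ i ∈ L, ∃ s, g s ∈ U ∧ l s.length = i := by
    intro i hi
    obtain ⟨u, hu, rfl⟩ := hreal i hi
    obtain ⟨s, rfl⟩ := hUg hu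
    exact ⟨s, hu, (hl s).symm⟩
  let L' : Finset ℕ := L.preimage l hinj.injOn
  have hL' : ∀ n, n ∈ L' ↔ l n ∈ L := fun n => Finset.mem_preimage
  have hdown : ∀ s ∈ downcl (g ⁻¹' U), g s ∈ downcl U := by
    rintro s ⟨t, ht, hst⟩
    exact ⟨g t, ht, hg.prefix_mono hst⟩
  refine ⟨L', ?_, ?_, ?_, ?_, ?_, ?_, ?_⟩
  · rw [← Finset.card_image_of_injective _ hinj]
    congr 1
    ext i
    rw [Finset.mem_image]
    refine ⟨?_, fun hi => ?_⟩
    · rintro ⟨n, hn, rfl⟩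
      exact (hL' n).1 hn
    · obtain ⟨s, -, rfl⟩ := hrange i hi
      exact ⟨_, (hL' _).2 hi, rfl⟩
  · obtain ⟨s, rfl⟩ := hUg hv₀
    exact ⟨s, hv₀⟩
  · intro s hs
    rw [hL', ← hl]
    exact hlen _ hs
  · intro s hs hsl
    refine hcl _ (hdown s hs) ?_
    rw [hl]
    exact (hL' _).1 hsl
  · rintro s hs ⟨n, hn, hsn⟩
    have hsp := hsplit _ hs ⟨l n, (hL' n).1 hn, hg.length_lt (by simpa using hsn)⟩
    rw [splits_iff] at hsp ⊢
    intro b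
    obtain ⟨u, hu, hsu⟩ := hsp b
    obtain ⟨t, rfl⟩ := hUg hu
    exact ⟨t, hu, hg.append_prefix_iff.1 hsu⟩
  · intro s hs hsp
    rw [hL', ← hl]
    refine hlev _ (hdown s hs) (splits_iff.2 fun b => ?_)
    obtain ⟨t, ht, hst⟩ := splits_iff.1 hsp b
    exact ⟨g t, ht, hg.append_prefix hst⟩
  · intro n hn
    obtain ⟨s, hs, hsn⟩ := hrange _ ((hL' n).1 hn)
    exact ⟨s, hs, hinj hsn⟩

/-- **Milliken's Theorem.** For each `k < ω`, each infinite strong subtree `T` of `2^{<ω}`,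
and each coloring of the finite strong subtrees of `T` with `k` levels into finitely many
colors, there is an infinite strong subtree `S ⊆ T` such that all finite strong subtrees of
`S` with `k` levels have the same color. -/
theorem milliken (k : ℕ) (T : Set (List Bool)) (hT : IsInfStrongTree T)
    (σ : ℕ) (c : Set (List Bool) → Fin (σ + 1)) :
    ∃ S : Set (List Bool), IsInfStrongTree S ∧ S ⊆ T ∧
      ∃ ε : Fin (σ + 1), ∀ (U : Set (List Bool)) (L : Finset ℕ),
        U ⊆ S → L.card = k → IsFinStrongTree U L → c U = ε := by
  obtain ⟨t, ht, htT⟩ := hT.exists_strongEmb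
  obtain ⟨g, hg, ε, hε⟩ := milliken_strongEmb k
    (fun f => c ((fun s => t (f s)) '' {s | s.length < k})) (by
      intro f f' _ _ hff
      exact congrArg c (Set.image_congr fun s hs => by rw [hff s hs]))
  have htg : IsStrongEmb fun s => t (g s) := ht.comp hg
  refine ⟨Set.range fun s => t (g s), htg.range_isInfStrongTree, ?_, ε, ?_⟩
  · rintro _ ⟨s, rfl⟩
    exact htT _
  · intro U L hUS hL hU
    obtain ⟨L', hL', hV⟩ := hU.preimage htg hUS
    obtain ⟨f, hf, hfV⟩ := hV.exists_strongEmb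
    rw [← hε f hf, ← Set.image_preimage_eq_of_subset hUS, hfV, Set.image_image, hL', hL]
end

section
/- A countable graph R has the extension property (for all disjoint finite sets U, V of vertices of R there is a vertex adjacent to every vertex of U and to no vertex of V) if and only if R is both universal for countable graphs (every countable graph embeds into R as an induced subgraph) and homogeneous (every isomorphism between two finite induced subgraphs of R extends to an automorphism of R). -/
/-- The extension property for a graph `R`: for all disjoint finite sets `U, W` of vertices
there is a vertex (outside `U ∪ W`) adjacent to every vertex of `U` and to no vertex of `W`. -/
def ExtensionProperty {V : Type} (R : SimpleGraph V) : Prop :=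
  ∀ U W : Finset V, Disjoint U W →
    ∃ v : V, v ∉ U ∧ v ∉ W ∧ (∀ u ∈ U, R.Adj v u) ∧ (∀ w ∈ W, ¬ R.Adj v w)

/-- Finite partial isomorphisms between two graphs, as finite relations that preserve and reflect
equality and adjacency. -/
def FinitePartialIso {A B : Type} (G : SimpleGraph A) (H : SimpleGraph B) : Type :=
  {f : Finset (A × B) // ∀ p ∈ f, ∀ q ∈ f,
    (p.1 = q.1 ↔ p.2 = q.2) ∧ (G.Adj p.1 q.1 ↔ H.Adj p.2 q.2)}

namespace FinitePartialIso

variable {A B : Type} {G : SimpleGraph A} {H : SimpleGraph B}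

instance : PartialOrder (FinitePartialIso G H) :=
  inferInstanceAs (PartialOrder (Subtype _))

/-- The inverse of a finite partial isomorphism. -/
def symm (f : FinitePartialIso G H) : FinitePartialIso H G :=
  ⟨f.1.map (Equiv.prodComm A B).toEmbedding, by
    intro p hp q hq
    obtain ⟨p', hp', rfl⟩ := Finset.mem_map.1 hp
    obtain ⟨q', hq', rfl⟩ := Finset.mem_map.1 hq
    exact ⟨(f.2 p' hp' q' hq').1.symm, (f.2 p' hp' q' hq').2.symm⟩⟩

theorem mem_symm (f : FinitePartialIso G H) (a : A) (b : B) :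
    (b, a) ∈ f.symm.1 ↔ (a, b) ∈ f.1 := by
  simp [symm]

theorem exists_le_mem_left (hH : ExtensionProperty H) (f : FinitePartialIso G H) (a : A) :
    ∃ g, f ≤ g ∧ ∃ b, (a, b) ∈ g.1 := by
  classical
  by_cases ha : ∃ b, (a, b) ∈ f.1
  · exact ⟨f, le_rfl, ha⟩
  obtain ⟨v, hvU, hvW, hU, hW⟩ := hH
    ((f.1.filter fun p => G.Adj a p.1).image Prod.snd)
    ((f.1.filter fun p => ¬ G.Adj a p.1).image Prod.snd) (by
      rw [Finset.disjoint_left]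
      intro b hb hb'
      simp only [Finset.mem_image, Finset.mem_filter] at hb hb'
      obtain ⟨p, ⟨hp, hpa⟩, rfl⟩ := hb
      obtain ⟨q, ⟨hq, hqa⟩, hqp⟩ := hb'
      exact hqa (((f.2 q hq p hp).1.2 hqp) ▸ hpa))
  have hne : ∀ p ∈ f.1, a ≠ p.1 ∧ v ≠ p.2 := by
    refine fun p hp => ⟨fun h => ha ⟨p.2, h ▸ hp⟩, fun h => ?_⟩
    by_cases hpa : G.Adj a p.1
    · exact hvU (Finset.mem_image.2 ⟨p, Finset.mem_filter.2 ⟨hp, hpa⟩, h.symm⟩)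
    · exact hvW (Finset.mem_image.2 ⟨p, Finset.mem_filter.2 ⟨hp, hpa⟩, h.symm⟩)
  have hadj : ∀ p ∈ f.1, (G.Adj a p.1 ↔ H.Adj v p.2) := by
    intro p hp
    by_cases hpa : G.Adj a p.1
    · exact iff_of_true hpa
        (hU _ (Finset.mem_image.2 ⟨p, Finset.mem_filter.2 ⟨hp, hpa⟩, rfl⟩))
    · exact iff_of_false hpa
        (hW _ (Finset.mem_image.2 ⟨p, Finset.mem_filter.2 ⟨hp, hpa⟩, rfl⟩))
  refine ⟨⟨insert (a, v) f.1, ?_⟩, Finset.subset_insert _ _, v, Finset.mem_insert_self _ _⟩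
  intro p hp q hq
  rcases Finset.mem_insert.1 hp with rfl | hp <;> rcases Finset.mem_insert.1 hq with rfl | hq
  · simp
  · exact ⟨iff_of_false (hne q hq).1 (hne q hq).2, hadj q hq⟩
  · exact ⟨iff_of_false (hne p hp).1.symm (hne p hp).2.symm, by
      rw [G.adj_comm, H.adj_comm]; exact hadj p hp⟩
  · exact f.2 p hp q hq

theorem exists_le_mem_right (hG : ExtensionProperty G) (f : FinitePartialIso G H) (b : B) :
    ∃ g, f ≤ g ∧ ∃ a, (a, b) ∈ g.1 := by
  obtain ⟨g, hfg, a, ha⟩ := exists_le_mem_left hG f.symm b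
  refine ⟨g.symm, fun p hp => ?_, a, (mem_symm g b a).2 ha⟩
  exact (mem_symm g p.2 p.1).2 (hfg ((mem_symm f p.1 p.2).2 hp))

/-- The finite partial isomorphisms defined at `a` are cofinal. -/
def definedAtLeft (hH : ExtensionProperty H) (a : A) : Order.Cofinal (FinitePartialIso G H) where
  carrier := {g | ∃ b, (a, b) ∈ g.1}
  isCofinal f := by
    obtain ⟨g, hfg, hg⟩ := exists_le_mem_left hH f a
    exact ⟨g, hg, hfg⟩

/-- The finite partial isomorphisms with `b` in their range are cofinal. -/
def definedAtRight (hG : ExtensionProperty G) (b : B) : Order.Cofinal (FinitePartialIso G H) where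
  carrier := {g | ∃ a, (a, b) ∈ g.1}
  isCofinal f := by
    obtain ⟨g, hfg, hg⟩ := exists_le_mem_right hG f b
    exact ⟨g, hg, hfg⟩

theorem compatible_of_mem_ideal (I : Order.Ideal (FinitePartialIso G H))
    {f g : FinitePartialIso G H} (hf : f ∈ I) (hg : g ∈ I) {p q : A × B}
    (hp : p ∈ f.1) (hq : q ∈ g.1) :
    (p.1 = q.1 ↔ p.2 = q.2) ∧ (G.Adj p.1 q.1 ↔ H.Adj p.2 q.2) := by
  obtain ⟨m, -, hfm, hgm⟩ := I.directed f hf g hg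
  exact m.2 p (hfm hp) q (hgm hq)

theorem exists_embedding [Countable A] (hH : ExtensionProperty H) : Nonempty (G ↪g H) := by
  have := Encodable.ofCountable A
  let f₀ : FinitePartialIso G H := ⟨∅, by simp⟩
  let I := Order.idealOfCofinals f₀ (definedAtLeft (G := G) hH)
  have hI : ∀ a, ∃ b, ∃ g ∈ I, (a, b) ∈ g.1 := fun a => by
    obtain ⟨g, ⟨b, hb⟩, hg⟩ := Order.cofinal_meets_idealOfCofinals f₀ (definedAtLeft hH) a
    exact ⟨b, g, hg, hb⟩
  choose F g hg hF using hI
  have key := fun a a' => compatible_of_mem_ideal I (hg a) (hg a') (hF a) (hF a')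
  exact ⟨⟨⟨F, fun a a' h => (key a a').1.2 h⟩, fun {a a'} => (key a a').2.symm⟩⟩

theorem exists_iso_extending [Countable A] [Countable B] (hG : ExtensionProperty G)
    (hH : ExtensionProperty H) (f : FinitePartialIso G H) :
    ∃ ψ : G ≃g H, ∀ p ∈ f.1, ψ p.1 = p.2 := by
  have := Encodable.ofCountable A
  have := Encodable.ofCountable B
  let D : A ⊕ B → Order.Cofinal (FinitePartialIso G H) :=
    Sum.elim (definedAtLeft hH) (definedAtRight hG)
  let I := Order.idealOfCofinals f D
  have hL : ∀ a, ∃ b, ∃ g ∈ I, (a, b) ∈ g.1 := fun a => by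
    obtain ⟨g, ⟨b, hb⟩, hg⟩ := Order.cofinal_meets_idealOfCofinals f D (Sum.inl a)
    exact ⟨b, g, hg, hb⟩
  have hR : ∀ b, ∃ a, ∃ g ∈ I, (a, b) ∈ g.1 := fun b => by
    obtain ⟨g, ⟨a, ha⟩, hg⟩ := Order.cofinal_meets_idealOfCofinals f D (Sum.inr b)
    exact ⟨a, g, hg, ha⟩
  choose F g hg hF using hL
  choose F' g' hg' hF' using hR
  refine ⟨⟨⟨F, F', fun a => ?_, fun b => ?_⟩, fun {a a'} => ?_⟩, fun p hp => ?_⟩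
  · exact (compatible_of_mem_ideal I (hg' _) (hg a) (hF' _) (hF a)).1.2 rfl
  · exact (compatible_of_mem_ideal I (hg _) (hg' b) (hF _) (hF' b)).1.1 rfl
  · exact (compatible_of_mem_ideal I (hg a) (hg a') (hF a) (hF a')).2.symm
  · exact (compatible_of_mem_ideal I (hg p.1) (Order.mem_idealOfCofinals f D)
      (hF p.1) hp).1.1 rfl

/-- An isomorphism between finite induced subgraphs as a finite partial isomorphism. -/
def ofInduceIso {s : Finset A} {t : Set B}
    (φ : G.induce (s : Set A) ≃g H.induce t) : FinitePartialIso G H :=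
  ⟨s.attach.map ⟨fun x => (x.1, (φ ⟨x.1, Finset.mem_coe.2 x.2⟩ : B)),
      fun _ _ h => Subtype.ext (congrArg Prod.fst h)⟩, by
    intro p hp q hq
    obtain ⟨x, -, rfl⟩ := Finset.mem_map.1 hp
    obtain ⟨y, -, rfl⟩ := Finset.mem_map.1 hq
    refine ⟨⟨fun h => ?_, fun h => ?_⟩, (φ.map_adj_iff (v := ⟨x.1, Finset.mem_coe.2 x.2⟩)
      (w := ⟨y.1, Finset.mem_coe.2 y.2⟩)).symm⟩
    · obtain rfl : x = y := Subtype.ext h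
      rfl
    · exact congrArg Subtype.val (φ.injective (Subtype.ext h))⟩

end FinitePartialIso

/-- The graph obtained from `G` by adding a new vertex `none` with neighbourhood `N`. -/
def SimpleGraph.addVertex {A : Type} (G : SimpleGraph A) (N : Set A) :
    SimpleGraph (Option A) where
  Adj
    | some a, some b => G.Adj a b
    | some a, none => a ∈ N
    | none, some a => a ∈ N
    | none, none => False
  symm := ⟨by rintro (_ | a) (_ | b) h <;> first | exact h | exact SimpleGraph.Adj.symm (G := G) h⟩
  loopless := ⟨by rintro (_ | a) h; exacts [h, G.loopless.irrefl a h]⟩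

theorem ExtensionProperty.of_universal_of_homogeneous {V : Type} [Countable V]
    {R : SimpleGraph V}
    (huniv : ∀ (W : Type) [Countable W], ∀ G : SimpleGraph W, Nonempty (G ↪g R))
    (hhom : ∀ (s t : Finset V) (φ : R.induce (s : Set V) ≃g R.induce (t : Set V)),
      ∃ ψ : R ≃g R, ∀ (v : V) (hv : v ∈ s),
        ψ v = ((φ ⟨v, Finset.mem_coe.mpr hv⟩ : (t : Set V)) : V)) :
    ExtensionProperty R := by
  classical
  intro U W hUW
  let s : Finset V := U ∪ W
  let N : Set (s : Set V) := {x | (x : V) ∈ U}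
  obtain ⟨e⟩ := huniv _ ((R.induce (s : Set V)).addVertex N)
  let t : Finset V := Finset.univ.image fun x : (s : Set V) => e (some x)
  have ht : ∀ x : (s : Set V), e (some x) ∈ (t : Set V) := fun x =>
    Finset.mem_coe.2 (Finset.mem_image_of_mem _ (Finset.mem_univ x))
  let φ : R.induce (s : Set V) ≃g R.induce (t : Set V) :=
    { toEquiv := Equiv.ofBijective (fun x => ⟨e (some x), ht x⟩)
        ⟨fun x y h => Option.some_injective _ (e.injective (congrArg Subtype.val h)), by
          rintro ⟨y, hy⟩
          obtain ⟨x, -, rfl⟩ := Finset.mem_image.1 (Finset.mem_coe.1 hy)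
          exact ⟨x, rfl⟩⟩
      map_rel_iff' := fun {x y} => e.map_adj_iff (v := some x) (w := some y) }
  obtain ⟨ψ, hψ⟩ := hhom s t φ
  have hne : ∀ v ∈ s, ψ.symm (e none) ≠ v := by
    rintro v hv rfl
    have h := hψ _ hv
    rw [RelIso.apply_symm_apply] at h
    exact Option.some_ne_none _ (e.injective h).symm
  have hadj : ∀ v ∈ s, (R.Adj (ψ.symm (e none)) v ↔ v ∈ U) := by
    intro v hv
    rw [← ψ.map_adj_iff, RelIso.apply_symm_apply, hψ v hv]
    exact e.map_adj_iff (v := none) (w := some ⟨v, Finset.mem_coe.2 hv⟩)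
  exact ⟨ψ.symm (e none), fun h => hne _ (Finset.mem_union_left _ h) rfl,
    fun h => hne _ (Finset.mem_union_right _ h) rfl,
    fun u hu => (hadj u (Finset.mem_union_left _ hu)).2 hu,
    fun w hw h => Finset.disjoint_left.1 hUW ((hadj w (Finset.mem_union_right _ hw)).1 h) hw⟩

/-- A countable graph `R` has the extension property if and only if `R` is both universal for
countable graphs (every countable graph embeds into `R` as an induced subgraph) and
homogeneous (every isomorphism between two finite induced subgraphs of `R` extends to an
automorphism of `R`). -/
theorem rado_characterization {V : Type} [Countable V] (R : SimpleGraph V) :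
    ExtensionProperty R ↔
      ((∀ (W : Type) [Countable W], ∀ G : SimpleGraph W, Nonempty (G ↪g R)) ∧
       (∀ (s t : Finset V) (φ : R.induce (s : Set V) ≃g R.induce (t : Set V)),
          ∃ ψ : R ≃g R, ∀ (v : V) (hv : v ∈ s),
            ψ v = ((φ ⟨v, Finset.mem_coe.mpr hv⟩ : (t : Set V)) : V))) := by
  refine ⟨fun h => ⟨fun W _ G => FinitePartialIso.exists_embedding h, fun s t φ => ?_⟩,
    fun h => ExtensionProperty.of_universal_of_homogeneous h.1 h.2⟩
  obtain ⟨ψ, hψ⟩ :=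
    FinitePartialIso.exists_iso_extending h h (FinitePartialIso.ofInduceIso φ)
  exact ⟨ψ, fun v hv => hψ (v, _)
    (Finset.mem_map.2 ⟨⟨v, hv⟩, Finset.mem_attach _ _, rfl⟩)⟩
end

section
/- For every Rado graph R and every coloring of the vertices of R into finitely many colors, there is an induced subgraph R' of R which is again a Rado graph and all of whose vertices have the same color. -/
/-- For every Rado graph `R` and every coloring of the vertices of `R` into finitely many
colors, there is an induced subgraph of `R` which is again a Rado graph (i.e. satisfies the
extension property) all of whose vertices have one color. -/
theorem rado_vertex_ramsey {V : Type} [Countable V] (R : SimpleGraph V)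
    (hR : ExtensionProperty R) (k : ℕ) (c : V → Fin (k + 1)) :
    ∃ (W : Set V) (ε : Fin (k + 1)),
      ExtensionProperty (R.induce W) ∧ ∀ v ∈ W, c v = ε := by
  classical
  by_contra! hne
  have hfail : ∀ ε, ¬ ExtensionProperty (R.induce {v | c v = ε}) := fun ε h => by
    obtain ⟨v, hv, hvε⟩ := hne {v | c v = ε} ε h
    exact hvε hv
  simp only [ExtensionProperty, not_forall] at hfail
  choose A B hAB hno using hfail
  let U : Finset V := Finset.univ.biUnion fun ε => (A ε).map (Function.Embedding.subtype _)
  let W : Finset V := Finset.univ.biUnion fun ε => (B ε).map (Function.Embedding.subtype _)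
  have hU : ∀ ε, ∀ a ∈ A ε, (a : V) ∈ U := fun ε a ha =>
    Finset.mem_biUnion.2 ⟨ε, Finset.mem_univ _, Finset.mem_map_of_mem _ ha⟩
  have hW : ∀ ε, ∀ b ∈ B ε, (b : V) ∈ W := fun ε b hb =>
    Finset.mem_biUnion.2 ⟨ε, Finset.mem_univ _, Finset.mem_map_of_mem _ hb⟩
  have hUW : Disjoint U W := by
    rw [Finset.disjoint_left]
    intro x hxU hxW
    obtain ⟨ε, -, hx⟩ := Finset.mem_biUnion.1 hxU
    obtain ⟨a, ha, rfl⟩ := Finset.mem_map.1 hx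
    obtain ⟨δ, -, hx'⟩ := Finset.mem_biUnion.1 hxW
    obtain ⟨b, hb, hab⟩ := Finset.mem_map.1 hx'
    replace hab : (b : V) = a := hab
    obtain rfl : δ = ε := b.2.symm.trans ((congrArg c hab).trans a.2)
    obtain rfl : b = a := Subtype.ext hab
    exact Finset.disjoint_left.1 (hAB _) ha hb
  obtain ⟨v, hvU, hvW, hadj, hnadj⟩ := hR U W hUW
  exact hno (c v) ⟨⟨v, rfl⟩, fun h => hvU (hU _ _ h), fun h => hvW (hW _ _ h),
    fun u hu => hadj u (hU _ u hu), fun w hw => hnadj w (hW _ w hw)⟩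
end
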